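/- Let f be a smooth symmetric concave function on Γ with f_i ≥ 0, and suppose ∑_i f_i(λ)λ_i ≥ −K ∑_i f_i(λ) for some K ≥ 0 and all λ ∈ Γ with A₁ ≤ f(λ) ≤ A₂, where sup_{∂Γ} f < A₁ < A₂ < sup_Γ f. Then there exists θ > 0 (depending on K, A₁, A₂) such that f_i(λ) ≥ θ(1 + ∑_{j=1}^n f_j(λ)) whenever λ_i ≤ −K and A₁ ≤ f(λ) ≤ A₂. -/

import Mathlib

open Finset Filter Topology

/-- The i-th partial derivative `f_i(x) = ∂f/∂x_i (x)`. -/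
noncomputable def pd {n : ℕ} (f : (Fin n → ℝ) → ℝ) (x : Fin n → ℝ) (i : Fin n) : ℝ :=
  fderiv ℝ f x (Pi.single i 1)

/-- The set of values `t_λ = (∑ f_i(λ) λ_i)/(∑ f_j(λ))` over the level set `∂Γ^σ`. -/
def tset {n : ℕ} (Γ : Set (Fin n → ℝ)) (f : (Fin n → ℝ) → ℝ) (σ : ℝ) : Set ℝ :=
  {t : ℝ | ∃ x ∈ Γ, f x = σ ∧ t = (∑ i, pd f x i * x i) / (∑ i, pd f x i)}

/-- The cone `Γ_{σ,f} = { t (λ - τ 𝟏) : λ ∈ ∂Γ^σ, t > 0 }`. -/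
def lcone {n : ℕ} (Γ : Set (Fin n → ℝ)) (f : (Fin n → ℝ) → ℝ) (σ τ : ℝ) :
    Set (Fin n → ℝ) :=
  {y | ∃ x ∈ Γ, f x = σ ∧ ∃ t : ℝ, 0 < t ∧ y = t • (x - fun _ => τ)}

/-- The set of `k` such that some vector with the first `k` coordinates negative and
the remaining coordinates positive belongs to `C`; `κ_C` is its greatest element. -/
def kset {n : ℕ} (C : Set (Fin n → ℝ)) : Set ℕ :=
  {k : ℕ | ∃ α : Fin n → ℝ, (∀ i, 0 < α i) ∧
    (fun i : Fin n => if (i : ℕ) < k then -α i else α i) ∈ C}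

section ConcaveOnCone

variable {n : ℕ} {Γ : Set (Fin n → ℝ)} {f : (Fin n → ℝ) → ℝ}

/-- The Fréchet derivative in terms of the partial derivatives. -/
lemma fderiv_apply_eq_sum_pd (f : (Fin n → ℝ) → ℝ) (x v : Fin n → ℝ) :
    fderiv ℝ f x v = ∑ i, pd f x i * v i := by
  have h := LinearMap.pi_apply_eq_sum_univ (fderiv ℝ f x).toLinearMap v
  simp only [ContinuousLinearMap.coe_coe, smul_eq_mul] at h
  rw [h]
  refine Finset.sum_congr rfl fun i _ => ?_
  rw [mul_comm, pd]
  congr 2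
  ext j
  simp [Pi.single_apply, eq_comm]

/-- A concave function lies below its tangent planes. -/
lemma ConcaveOn.le_add_sum_pd (hconc : ConcaveOn ℝ Γ f) {x y : Fin n → ℝ}
    (hx : x ∈ Γ) (hy : y ∈ Γ) (hd : DifferentiableAt ℝ f x) :
    f y ≤ f x + ∑ i, pd f x i * (y i - x i) := by
  have hg : ConcaveOn ℝ (AffineMap.lineMap x y ⁻¹' Γ) (f ∘ AffineMap.lineMap (k := ℝ) x y) :=
    hconc.comp_affineMap _
  have hder : HasDerivAt (f ∘ AffineMap.lineMap (k := ℝ) x y) (fderiv ℝ f x (y - x)) 0 := by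
    have h1 : HasFDerivAt f (fderiv ℝ f x) (AffineMap.lineMap (k := ℝ) x y 0) := by
      simpa using hd.hasFDerivAt
    exact h1.comp_hasDerivAt _ AffineMap.hasDerivAt_lineMap
  have hs := hg.slope_le_of_hasDerivAt (x := 0) (y := 1) (by simpa using hx)
    (by simpa using hy) one_pos hder
  rw [fderiv_apply_eq_sum_pd] at hs
  simp [slope_def_field] at hs
  linarith

/-- For a symmetric function, partial derivatives in directions with equal coordinates agree. -/
lemma pd_eq_of_coord_eq (hopen : IsOpen Γ)
    (hfsym : ∀ (g : Equiv.Perm (Fin n)), ∀ x ∈ Γ, f (x ∘ g) = f x)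
    {x : Fin n → ℝ} (hx : x ∈ Γ) (hd : DifferentiableAt ℝ f x) {i l : Fin n}
    (hil : x i = x l) : pd f x i = pd f x l := by
  have hline : ∀ v : Fin n → ℝ,
      HasDerivAt (fun t : ℝ => f (x + t • v)) (fderiv ℝ f x v) 0 := fun v => by
    have h1 : HasFDerivAt f (fderiv ℝ f x) (x + (0 : ℝ) • v) := by
      simpa using hd.hasFDerivAt
    have h2 : HasDerivAt (fun t : ℝ => x + t • v) v 0 := by
      simpa using ((hasDerivAt_id (0 : ℝ)).smul_const v).const_add x
    exact h1.comp_hasDerivAt _ h2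
  have hswap : ∀ t : ℝ, (x + t • Pi.single i (1 : ℝ)) ∘ Equiv.swap i l
      = x + t • Pi.single l (1 : ℝ) := fun t => by
    ext j
    by_cases hjl : j = l
    · subst hjl
      simp [hil]
    · by_cases hji : j = i
      · subst hji
        simp [hil, Ne.symm hjl, hjl]
      · simp [Equiv.swap_apply_of_ne_of_ne hji hjl, hji, hjl]
  have hmem : ∀ᶠ t : ℝ in 𝓝 0, x + t • Pi.single i (1 : ℝ) ∈ Γ := by
    have hc : Continuous fun t : ℝ => x + t • (Pi.single i (1 : ℝ) : Fin n → ℝ) := by fun_prop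
    exact hc.continuousAt.eventually (hopen.mem_nhds (by simpa using hx))
  have heq : (fun t : ℝ => f (x + t • Pi.single l (1 : ℝ)))
      =ᶠ[𝓝 0] fun t : ℝ => f (x + t • Pi.single i (1 : ℝ)) := by
    filter_upwards [hmem] with t ht
    rw [← hswap t, hfsym _ _ ht]
  exact ((hline _).congr_of_eventuallyEq heq).unique (hline _)

/-- Partial derivatives of a symmetric concave function are ordered oppositely to the
coordinates. -/
lemma pd_antitone_coord (hopen : IsOpen Γ)
    (hΓsym : ∀ (g : Equiv.Perm (Fin n)), ∀ x ∈ Γ, x ∘ g ∈ Γ)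
    (hfsym : ∀ (g : Equiv.Perm (Fin n)), ∀ x ∈ Γ, f (x ∘ g) = f x)
    (hconc : ConcaveOn ℝ Γ f) {x : Fin n → ℝ} (hx : x ∈ Γ) (hd : DifferentiableAt ℝ f x)
    {i l : Fin n} (hil : x i ≤ x l) : pd f x l ≤ pd f x i := by
  rcases hil.eq_or_lt with h | h
  · exact (pd_eq_of_coord_eq hopen hfsym hx hd h).ge
  · have hne : i ≠ l := fun h' => by simp [h'] at h
    have hs := hconc.le_add_sum_pd hx (hΓsym (Equiv.swap i l) x hx) hd
    rw [hfsym _ _ hx, Fintype.sum_eq_add i l hne] at hs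
    · simp only [Function.comp_apply, Equiv.swap_apply_left, Equiv.swap_apply_right] at hs
      nlinarith
    · rintro j ⟨hji, hjl⟩
      simp [Equiv.swap_apply_of_ne_of_ne hji hjl]

/-- Translating by a nonnegative multiple of the all-ones vector preserves a convex cone
containing the positive orthant. -/
lemma add_const_mem_of_cone (hconv : Convex ℝ Γ)
    (hcone : ∀ x ∈ Γ, ∀ t : ℝ, 0 < t → t • x ∈ Γ)
    (horth : {x : Fin n → ℝ | ∀ i, 0 < x i} ⊆ Γ) {x : Fin n → ℝ} (hx : x ∈ Γ) {c : ℝ}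
    (hc : 0 ≤ c) : (fun i => x i + c) ∈ Γ := by
  rcases hc.eq_or_lt with rfl | hc
  · simpa using hx
  · have h := hcone _ (hconv hx (horth (fun _ => hc : ∀ i : Fin n, 0 < (fun _ => c) i))
      (by norm_num : (0 : ℝ) ≤ 1 / 2) (by norm_num : (0 : ℝ) ≤ 1 / 2) (by norm_num)) 2 two_pos
    convert h using 1
    ext i
    simp
    ring

variable {K A₁ A₂ : ℝ}

/-- Dilating about `-K 𝟏` keeps `f` above the level `A₁`. -/
lemma le_apply_dilation (hconv : Convex ℝ Γ)
    (hcone : ∀ x ∈ Γ, ∀ t : ℝ, 0 < t → t • x ∈ Γ)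
    (horth : {x : Fin n → ℝ | ∀ i, 0 < x i} ⊆ Γ) (hconc : ConcaveOn ℝ Γ f)
    (hdiff : ∀ x ∈ Γ, DifferentiableAt ℝ f x) (hK : 0 ≤ K) (hA : A₁ < A₂)
    (hcond : ∀ lam ∈ Γ, A₁ ≤ f lam → f lam ≤ A₂ →
      -K * ∑ i, pd f lam i ≤ ∑ i, pd f lam i * lam i)
    {x : Fin n → ℝ} (hx : x ∈ Γ) (hfx : A₁ < f x) {T : ℝ} (hT : 1 ≤ T) :
    (fun i => T * (x i + K) - K) ∈ Γ ∧ A₁ ≤ f (fun i => T * (x i + K) - K) := by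
  have hmem : ∀ t : ℝ, 1 ≤ t → (fun i => t * (x i + K) - K) ∈ Γ := fun t ht => by
    have h := add_const_mem_of_cone hconv hcone horth (hcone x hx t (by linarith))
      (mul_nonneg (sub_nonneg.2 ht) hK)
    convert h using 2 with i
    simp
    ring
  refine ⟨hmem T hT, ?_⟩
  by_contra! hlt
  have hcont : ContinuousOn (fun t : ℝ => f (fun i => t * (x i + K) - K)) (Set.Icc 1 T) := by
    intro t ht
    have h2 : Continuous fun t : ℝ => (fun i => t * (x i + K) - K : Fin n → ℝ) := by fun_prop
    exact (ContinuousAt.comp (f := fun t : ℝ => (fun i => t * (x i + K) - K : Fin n → ℝ))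
      (hdiff _ (hmem t ht.1)).continuousAt h2.continuousAt).continuousWithinAt
  obtain ⟨s, ⟨hs1, -⟩, hs⟩ := intermediate_value_Icc' hT hcont
    (show A₁ ∈ _ from ⟨hlt.le, by simpa using hfx.le⟩)
  simp only at hs
  set y : Fin n → ℝ := fun i => s * (x i + K) - K with hy
  have htan := hconc.le_add_sum_pd (hmem s hs1) hx (hdiff _ (hmem s hs1))
  have hc := hcond y (hmem s hs1) hs.ge (by linarith)
  have hsum : s * ∑ i, pd f y i * (x i - y i)
      = (1 - s) * (∑ i, pd f y i * y i + K * ∑ i, pd f y i) := by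
    simp only [Finset.mul_sum, ← Finset.sum_add_distrib]
    refine Finset.sum_congr rfl fun i _ => ?_
    simp only [hy]
    ring
  have hpos : 0 < ∑ i, pd f y i * (x i - y i) := by linarith
  nlinarith [mul_pos (by linarith : 0 < s) hpos]

/-- If `f` is at least `A₁` at some point whose coordinates in `S` are below `-K`, then `f` is
at least `A₂` at some point whose coordinates in `S` are at most `-K - 1`. -/
lemma exists_high_point (hconv : Convex ℝ Γ)
    (hcone : ∀ x ∈ Γ, ∀ t : ℝ, 0 < t → t • x ∈ Γ)
    (horth : {x : Fin n → ℝ | ∀ i, 0 < x i} ⊆ Γ) (hconc : ConcaveOn ℝ Γ f)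
    (hdiff : ∀ x ∈ Γ, DifferentiableAt ℝ f x) (hK : 0 ≤ K) (hA : A₁ < A₂)
    (hA2 : ∃ μ ∈ Γ, A₂ < f μ)
    (hcond : ∀ lam ∈ Γ, A₁ ≤ f lam → f lam ≤ A₂ →
      -K * ∑ i, pd f lam i ≤ ∑ i, pd f lam i * lam i)
    {S : Set (Fin n)} {x : Fin n → ℝ} (hx : x ∈ Γ) (hfx : A₁ ≤ f x) (hS : ∀ i ∈ S, x i < -K) :
    ∃ μ ∈ Γ, A₂ ≤ f μ ∧ ∀ i ∈ S, μ i ≤ -K - 1 := by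
  obtain ⟨μ, hμ, hfμ⟩ := hA2
  have hev : ∀ᶠ ε : ℝ in 𝓝[>] 0, ∀ i, i ∈ S → (1 - ε) * x i + ε * μ i < -K := by
    refine eventually_all.2 fun i => ?_
    by_cases hi : i ∈ S
    · have hc : Continuous fun ε : ℝ => (1 - ε) * x i + ε * μ i := by fun_prop
      have h0 : ∀ᶠ ε : ℝ in 𝓝 0, (1 - ε) * x i + ε * μ i < -K :=
        hc.continuousAt.eventually (gt_mem_nhds (by simpa using hS i hi))
      exact (h0.filter_mono nhdsWithin_le_nhds).mono fun ε h _ => h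
    · exact Eventually.of_forall fun _ h => absurd h hi
  have hlt1 : ∀ᶠ ε : ℝ in 𝓝[>] 0, ε < 1 := nhdsWithin_le_nhds (gt_mem_nhds one_pos)
  obtain ⟨ε, hε, hε1, hε0⟩ := (hev.and (hlt1.and self_mem_nhdsWithin)).exists
  have hε0 : 0 < ε := hε0
  set z : Fin n → ℝ := (1 - ε) • x + ε • μ with hz
  have hzΓ : z ∈ Γ := hconv hx hμ (by linarith) hε0.le (by ring)
  have hfz : A₁ < f z := by
    have h := hconc.2 hx hμ (by linarith : 0 ≤ 1 - ε) hε0.le (by ring)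
    simp only [smul_eq_mul] at h
    nlinarith
  have hzS : ∀ i ∈ S, z i < -K := fun i hi => by simpa [hz] using hε i hi
  obtain ⟨δ, hδ0, hδ1, hδ⟩ : ∃ δ : ℝ, 0 < δ ∧ δ < 1 ∧ A₂ = δ * A₁ + (1 - δ) * f μ := by
    have hpos : 0 < f μ - A₁ := by linarith
    refine ⟨(f μ - A₂) / (f μ - A₁), div_pos (by linarith) hpos, ?_, ?_⟩
    · rw [div_lt_one hpos]; linarith
    · field_simp
      ring
  have hevt : ∀ᶠ t : ℝ in atTop, ∀ i, i ∈ S →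
      δ * (t * (z i + K) - K) + (1 - δ) * μ i ≤ -K - 1 := by
    refine eventually_all.2 fun i => ?_
    by_cases hi : i ∈ S
    · have hneg : z i + K < 0 := by linarith [hzS i hi]
      have ht : Tendsto (fun t : ℝ => δ * (t * (z i + K) - K) + (1 - δ) * μ i) atTop atBot := by
        refine tendsto_atBot_add_const_right _ _ (Tendsto.const_mul_atBot hδ0 ?_)
        exact tendsto_atBot_add_const_right _ _ (tendsto_id.atTop_mul_const_of_neg hneg)
      exact (ht.eventually_le_atBot _).mono fun t h _ => h
    · exact Eventually.of_forall fun _ h => absurd h hi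
  obtain ⟨t, ht, ht1⟩ := (hevt.and (eventually_ge_atTop 1)).exists
  obtain ⟨hyΓ, hfy⟩ :=
    le_apply_dilation hconv hcone horth hconc hdiff hK hA hcond hzΓ hfz ht1
  refine ⟨_, hconv hyΓ hμ hδ0.le (by linarith : 0 ≤ 1 - δ) (by ring), ?_, fun i hi => ?_⟩
  · have h := hconc.2 hyΓ hμ hδ0.le (by linarith : 0 ≤ 1 - δ) (by ring)
    refine le_trans ?_ h
    simp only [smul_eq_mul]
    nlinarith
  · simpa using ht i hi

/-- On the level range, `∑ f_i μ_i ≥ f μ - A₂ - K ∑ f_i`. -/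
lemma sub_le_sum_pd_mul_add (hconc : ConcaveOn ℝ Γ f)
    (hdiff : ∀ x ∈ Γ, DifferentiableAt ℝ f x)
    (hcond : ∀ lam ∈ Γ, A₁ ≤ f lam → f lam ≤ A₂ →
      -K * ∑ i, pd f lam i ≤ ∑ i, pd f lam i * lam i)
    {x μ : Fin n → ℝ} (hx : x ∈ Γ) (h1 : A₁ ≤ f x) (h2 : f x ≤ A₂) (hμ : μ ∈ Γ) :
    f μ - A₂ ≤ ∑ i, pd f x i * (μ i + K) := by
  have ht := hconc.le_add_sum_pd hx hμ (hdiff x hx)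
  have hc := hcond x hx h1 h2
  simp only [mul_sub, Finset.sum_sub_distrib] at ht
  simp only [mul_add, Finset.sum_add_distrib, ← Finset.sum_mul]
  linarith

end ConcaveOnCone

theorem stmt6 {n : ℕ} (Γ : Set (Fin n → ℝ)) (f : (Fin n → ℝ) → ℝ)
    (hopen : IsOpen Γ) (hconv : Convex ℝ Γ)
    (hcone : ∀ x ∈ Γ, ∀ t : ℝ, 0 < t → t • x ∈ Γ)
    (horth : {x : Fin n → ℝ | ∀ i, 0 < x i} ⊆ Γ)
    (hbdry : (frontier Γ).Nonempty)
    (hΓsym : ∀ (g : Equiv.Perm (Fin n)), ∀ x ∈ Γ, x ∘ g ∈ Γ)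
    (hfsym : ∀ (g : Equiv.Perm (Fin n)), ∀ x ∈ Γ, f (x ∘ g) = f x)
    (hconc : ConcaveOn ℝ Γ f)
    (hsmooth : ContDiffOn ℝ (⊤ : ℕ∞) f Γ)
    (hdiff : ∀ x ∈ Γ, DifferentiableAt ℝ f x)
    (hpd : ∀ x ∈ Γ, ∀ i, 0 ≤ pd f x i)
    (K A₁ A₂ : ℝ) (hK : 0 ≤ K) (hA : A₁ < A₂)
    (hA1 : ∀ x ∈ frontier Γ, Filter.limsup f (𝓝[Γ] x) < A₁)
    (hA2 : ∃ μ ∈ Γ, A₂ < f μ)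
    (hcond : ∀ lam ∈ Γ, A₁ ≤ f lam → f lam ≤ A₂ →
      -K * ∑ i, pd f lam i ≤ ∑ i, pd f lam i * lam i) :
    ∃ θ : ℝ, 0 < θ ∧ ∀ lam ∈ Γ, A₁ ≤ f lam → f lam ≤ A₂ →
      ∀ i : Fin n, lam i ≤ -K → θ * (1 + ∑ j, pd f lam j) ≤ pd f lam i := by
  have hbound : ∀ μ : Fin n → ℝ, ∃ B : ℝ, 0 < B ∧ ∀ i, μ i + K ≤ B := fun μ =>
    ⟨∑ i, |μ i + K| + 1, by positivity, fun i => by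
      have := Finset.single_le_sum (f := fun i => |μ i + K|) (fun j _ => abs_nonneg _)
        (Finset.mem_univ i)
      linarith [le_abs_self (μ i + K)]⟩
  obtain ⟨c, hc0, hc⟩ : ∃ c : ℝ, 0 < c ∧ ∀ lam ∈ Γ, A₁ ≤ f lam → f lam ≤ A₂ →
      1 ≤ c * ∑ j, pd f lam j := by
    obtain ⟨μ, hμ, hfμ⟩ := hA2
    obtain ⟨B, hB0, hB⟩ := hbound μ
    have hpos : 0 < f μ - A₂ := by linarith
    refine ⟨B / (f μ - A₂), div_pos hB0 hpos, fun lam hl h1 h2 => ?_⟩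
    have h := sub_le_sum_pd_mul_add hconc hdiff hcond hl h1 h2 hμ
    have h' : ∑ i, pd f lam i * (μ i + K) ≤ B * ∑ i, pd f lam i := by
      rw [Finset.mul_sum]
      exact Finset.sum_le_sum fun i _ => by nlinarith [hpd lam hl i, hB i]
    rw [div_mul_eq_mul_div, one_le_div hpos]
    linarith
  have hsupport : ∀ S : Set (Fin n), ∃ C : ℝ, 0 ≤ C ∧ ∀ lam ∈ Γ, A₁ ≤ f lam → f lam ≤ A₂ →
      S = {l | lam l < -K} → ∀ i, lam i ≤ -K → ∑ j, pd f lam j ≤ C * pd f lam i := by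
    intro S
    by_cases hex : ∃ x ∈ Γ, A₁ ≤ f x ∧ ∀ i ∈ S, x i < -K
    · obtain ⟨x, hx, hfx, hxS⟩ := hex
      obtain ⟨μ, hμ, hfμ, hμS⟩ :=
        exists_high_point hconv hcone horth hconc hdiff hK hA hA2 hcond hx hfx hxS
      obtain ⟨B, hB0, hB⟩ := hbound μ
      refine ⟨n * (B + 1), by positivity, fun lam hl h1 h2 hS i hi => ?_⟩
      have h := sub_le_sum_pd_mul_add hconc hdiff hcond hl h1 h2 hμ
      have hterm : ∀ l, pd f lam l * (μ l + K) ≤ (B + 1) * pd f lam i - pd f lam l := by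
        intro l
        have hl0 := hpd lam hl l
        have hi0 := hpd lam hl i
        by_cases hlS : l ∈ S
        · nlinarith [hμS l hlS]
        · have hlK : -K ≤ lam l := by simpa [hS] using hlS
          have hle := pd_antitone_coord hopen hΓsym hfsym hconc hl (hdiff lam hl) (hi.trans hlK)
          nlinarith [hB l]
      have hsum := Finset.sum_le_sum fun l (_ : l ∈ Finset.univ) => hterm l
      simp only [Finset.sum_sub_distrib, Finset.sum_const, Finset.card_univ, Fintype.card_fin,
        nsmul_eq_mul] at hsum
      linarith
    · refine ⟨0, le_rfl, fun lam hl h1 h2 hS i hi => ?_⟩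
      exact absurd ⟨lam, hl, h1, fun j hj => by simpa [hS] using hj⟩ hex
  choose C hC0 hC using hsupport
  have hCle : ∀ S, C S ≤ ∑ S', C S' := fun S =>
    Finset.single_le_sum (fun S' _ => hC0 S') (Finset.mem_univ S)
  have hCsum : 0 ≤ ∑ S', C S' := Finset.sum_nonneg fun S' _ => hC0 S'
  have hden : 0 < (c + 1) * (∑ S', C S' + 1) := by positivity
  refine ⟨1 / ((c + 1) * (∑ S', C S' + 1)), by positivity, fun lam hl h1 h2 i hi => ?_⟩
  rw [one_div_mul_eq_div, div_le_iff₀ hden]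
  have hi0 := hpd lam hl i
  calc 1 + ∑ j, pd f lam j ≤ (c + 1) * ∑ j, pd f lam j := by linarith [hc lam hl h1 h2]
    _ ≤ (c + 1) * ((∑ S', C S' + 1) * pd f lam i) := by
        gcongr
        refine (hC _ lam hl h1 h2 rfl i hi).trans ?_
        gcongr
        linarith [hCle {l | lam l < -K}]
    _ = pd f lam i * ((c + 1) * (∑ S', C S' + 1)) := by ring
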